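/- arXiv:2111.07883 — 6 statements merged into one kernel-verified Lean document; each statement's English description precedes it below -/
import Mathlib

section
/- The function χ_H : ℕ → ℚ satisfies the system of functional equations χ_H(ϱ·n + j) = (a_j·χ_H(n) + b_j)/d_j for all n ∈ ℕ and all j ∈ {0,…,ϱ−1}. -/
/-- `Mstr a d l = ∏_{k=1}^{L} a_{j_k}/d_{j_k}` for the string `l = (j_1, …, j_L)`. -/
def Mstr (a d : ℕ → ℤ) (l : List ℕ) : ℚ :=
  (l.map fun j => (a j : ℚ) / (d j : ℚ)).prod

/-- `chiStr a b d l = Σ_{m=1}^{L} (b_{j_m}/d_{j_m}) ∏_{k=1}^{m−1} a_{j_k}/d_{j_k}`. -/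
def chiStr (a b d : ℕ → ℤ) (l : List ℕ) : ℚ :=
  ∑ m ∈ Finset.range l.length,
    ((l.map fun j => (b j : ℚ) / (d j : ℚ)).getD m 0) * Mstr a d (l.take m)

/-- `chiH a b d ϱ n = χ_H(j)` for the string `j` of base-`ϱ` digits of `n`
(least significant first, no trailing zeros); `chiH a b d ϱ 0 = 0`. -/
def chiH (a b d : ℕ → ℤ) (ϱ n : ℕ) : ℚ := chiStr a b d (Nat.digits ϱ n)

/-- The empty string has `χ_H` value `0`. -/
theorem chiStr_nil (a b d : ℕ → ℤ) : chiStr a b d [] = 0 := by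
  simp [chiStr]

/-- Prepending the digit `j` to a string `l` applies the branch
`x ↦ (a_j x + b_j) / d_j` to `χ_H(l)`. -/
theorem chiStr_cons (a b d : ℕ → ℤ) (j : ℕ) (l : List ℕ) :
    chiStr a b d (j :: l) = ((a j : ℚ) * chiStr a b d l + (b j : ℚ)) / (d j : ℚ) := by
  simp only [chiStr, Mstr, List.length_cons, Finset.sum_range_succ', List.map_cons,
    List.getD_cons_succ, List.getD_cons_zero, List.take_succ_cons, List.take_zero,
    List.map_nil, List.prod_cons, List.prod_nil, mul_one, add_div, Finset.mul_sum,
    Finset.sum_div]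
  congr 1
  exact Finset.sum_congr rfl fun _ _ => by ring

/-- `χ_H(ϱ·n + j) = (a_j·χ_H(n) + b_j)/d_j` for all `n ∈ ℕ` and
all `j ∈ {0,…,ϱ−1}`. -/
theorem stmt2 (ϱ : ℕ) (hϱ : 2 ≤ ϱ) (a d b : ℕ → ℤ)
    (ha : ∀ j < ϱ, 0 < a j) (hd : ∀ j < ϱ, 0 < d j) (hb0 : b 0 = 0)
    (n : ℕ) (j : ℕ) (hj : j < ϱ) :
    chiH a b d ϱ (ϱ * n + j)
      = ((a j : ℚ) * chiH a b d ϱ n + (b j : ℚ)) / (d j : ℚ) := by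
  by_cases h : j = 0 ∧ n = 0
  · obtain ⟨rfl, rfl⟩ := h
    simp [chiH, chiStr_nil, hb0]
  · rw [chiH, add_comm, Nat.digits_add ϱ hϱ j n hj (by tauto), chiStr_cons, chiH]
end

section
/- Suppose a_0 ≠ d_0. If f : ℕ → ℚ satisfies f(ϱ·n + j) = (a_j·f(n) + b_j)/d_j for all n ∈ ℕ and all j ∈ {0,…,ϱ−1}, then f(n) = χ_H(n) for all n ∈ ℕ; in particular χ_H is the unique rational-valued function on ℕ satisfying this system of functional equations. -/
/-- suppose `a_0 ≠ d_0`. If `f : ℕ → ℚ` satisfies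
`f(ϱ·n + j) = (a_j·f(n) + b_j)/d_j` for all `n ∈ ℕ` and all `j ∈ {0,…,ϱ−1}`,
then `f = χ_H`. -/
theorem stmt3 (ϱ : ℕ) (hϱ : 2 ≤ ϱ) (a d b : ℕ → ℤ)
    (ha : ∀ j < ϱ, 0 < a j) (hd : ∀ j < ϱ, 0 < d j) (hb0 : b 0 = 0)
    (had : a 0 ≠ d 0)
    (f : ℕ → ℚ)
    (hf : ∀ n : ℕ, ∀ j < ϱ, f (ϱ * n + j) = ((a j : ℚ) * f n + (b j : ℚ)) / (d j : ℚ)) :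
    ∀ n : ℕ, f n = chiH a b d ϱ n := by
  have h_pos : 0 < ϱ := by omega
  have hd0 : (d 0 : ℚ) ≠ 0 := by exact_mod_cast (hd 0 h_pos).ne'
  have h_ne : (d 0 : ℚ) - a 0 ≠ 0 := sub_ne_zero.mpr (by exact_mod_cast had.symm)
  have hf0 : f 0 = 0 := by
    have h := hf 0 0 h_pos
    rw [mul_zero, add_zero, hb0, Int.cast_zero, add_zero, eq_div_iff hd0] at h
    have h_mul : ((d 0 : ℚ) - a 0) * f 0 = 0 := by linear_combination h
    exact (mul_eq_zero.mp h_mul).resolve_left h_ne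
  intro n
  induction n using Nat.strong_induction_on with
  | _ n ih =>
    rcases Nat.eq_zero_or_pos n with rfl | hn
    · simp [hf0, chiH, chiStr]
    · rw [chiH, Nat.digits_def' (by omega) hn, chiStr_cons, ← chiH,
        ← ih (n / ϱ) (Nat.div_lt_self hn (by omega)), ← hf _ _ (Nat.mod_lt n h_pos),
        Nat.div_add_mod]
end

section
/- Suppose H is basic. Then H is proper: for every finite string j = (j_1,…,j_L) with L ≥ 1 of elements of {0,…,ϱ−1} and every integer n whose residue mod ϱ is not equal to j_L, the rational number (H_{j_1} ∘ ⋯ ∘ H_{j_L})(n) is not an integer. -/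
/-- `qH ϱ a` is the greatest common divisor of the set `{a_j : j < ϱ, a_j ≠ 1}`. -/
def qH (ϱ : ℕ) (a : ℕ → ℤ) : ℤ :=
  Finset.gcd ((Finset.range ϱ).filter fun j => a j ≠ 1) a

/-- Applying branches `x ↦ (a j * x + b j) / ϱ`, each with `a j` coprime to `ϱ`, to a fraction
`c / ϱ` with `ϱ ∤ c` gives a fraction whose numerator is not divisible by `ϱ` and whose denominator
is a positive power of `ϱ`. -/
theorem foldr_branch_eq_div_pow {ϱ : ℕ} (hϱ : ϱ ≠ 0) {a b : ℕ → ℤ} {l : List ℕ}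
    (hcop : ∀ j ∈ l, Int.gcd (a j) (ϱ : ℤ) = 1) {c : ℤ} (hc : ¬ (ϱ : ℤ) ∣ c) {y : ℚ}
    (hy : y = c / ϱ) :
    ∃ (d : ℤ) (k : ℕ), ¬ (ϱ : ℤ) ∣ d ∧
      l.foldr (fun j y => ((a j : ℚ) * y + (b j : ℚ)) / (ϱ : ℚ)) y = d / (ϱ : ℚ) ^ (k + 1) := by
  induction l with
  | nil => exact ⟨c, 0, hc, by simp [hy]⟩
  | cons j l ih =>
    obtain ⟨d, k, hd, h⟩ := ih fun i hi => hcop i (List.mem_cons_of_mem j hi)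
    refine ⟨a j * d + b j * (ϱ : ℤ) ^ (k + 1), k + 1, fun hdvd => hd ?_, ?_⟩
    · have hpow : (ϱ : ℤ) ∣ b j * (ϱ : ℤ) ^ (k + 1) :=
        (dvd_pow_self _ k.succ_ne_zero).mul_left _
      have hgcd : Int.gcd (ϱ : ℤ) (a j) = 1 := by
        rw [Int.gcd_comm]
        exact hcop j List.mem_cons_self
      exact Int.dvd_of_dvd_mul_right_of_gcd_one ((dvd_add_left hpow).mp hdvd) hgcd
    · have hϱ' : (ϱ : ℚ) ≠ 0 := Nat.cast_ne_zero.mpr hϱ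
      rw [List.foldr_cons, h]
      push_cast
      field_simp
      ring

/-- if `H` is basic then `H` is proper: for every finite string
`j = (j_1,…,j_L)` with `L ≥ 1` of elements of `{0,…,ϱ−1}` (written here as
`l ++ [jL]`) and every integer `n` whose residue mod `ϱ` is not `j_L`, the
rational number `(H_{j_1} ∘ ⋯ ∘ H_{j_L})(n)` is not an integer. -/
theorem stmt11 (ϱ : ℕ) (hϱ : 2 ≤ ϱ) (a b : ℕ → ℤ)
    (ha : ∀ j < ϱ, 0 < a j) (hb0 : b 0 = 0)
    (hcop : ∀ j < ϱ, Int.gcd (a j) (ϱ : ℤ) = 1)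
    (hnd : ∀ j, 0 < j → j < ϱ → a j ≠ 1)
    (hq : (2 : ℤ) ≤ qH ϱ a)
    (hint : ∀ j < ϱ, ∀ ℓ : ℤ, (ϱ : ℤ) ∣ (a j * ℓ + b j) ↔ ℓ % (ϱ : ℤ) = (j : ℤ))
    (l : List ℕ) (jL : ℕ) (hl : ∀ x ∈ l ++ [jL], x < ϱ)
    (n : ℤ) (hn : n % (ϱ : ℤ) ≠ (jL : ℤ)) :
    ¬ ∃ z : ℤ,
      (l ++ [jL]).foldr (fun j y => ((a j : ℚ) * y + (b j : ℚ)) / (ϱ : ℚ)) (n : ℚ)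
        = (z : ℚ) := by
  rintro ⟨z, hz⟩
  have hϱ0 : ϱ ≠ 0 := by omega
  have hϱ' : (ϱ : ℚ) ≠ 0 := Nat.cast_ne_zero.mpr hϱ0
  have hc : ¬ (ϱ : ℤ) ∣ a jL * n + b jL := fun h => hn ((hint jL (hl jL (by simp)) n).mp h)
  obtain ⟨d, k, hd, h⟩ := foldr_branch_eq_div_pow (b := b) hϱ0
    (fun j hj => hcop j (hl j (List.mem_append_left _ hj))) hc
    (y := ((a jL : ℚ) * n + b jL) / ϱ) (by push_cast; rfl)
  rw [List.foldr_append, List.foldr_cons, List.foldr_nil, h,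
    div_eq_iff (pow_ne_zero _ hϱ')] at hz
  have hdz : d = z * (ϱ : ℤ) ^ (k + 1) := by exact_mod_cast hz
  exact hd (hdz ▸ (dvd_pow_self _ k.succ_ne_zero).mul_left _)
end

section
/- Suppose b_0 = 0 and a_0 ≠ d_0. If n ∈ ℤ, m ≥ 1, H^{∘m}(n) = n, and ϱ divides H^{∘k}(n) for every 0 ≤ k ≤ m−1, then n = 0. (Equivalently: any periodic point of H whose cycle applies only the branch with index 0 is the fixed point 0; hence every cycle of H containing at least two elements must at some point apply a branch with non-zero index.) -/
/-- If `d * H x = a * x` at the first `k` points of the orbit of `n`,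
then `d ^ k * H^[k] n = a ^ k * n`. -/
theorem pow_mul_iterate_eq {R : Type*} [CommRing R] {H : R → R} {a d n : R} {k : ℕ}
    (h : ∀ i < k, d * H (H^[i] n) = a * H^[i] n) :
    d ^ k * H^[k] n = a ^ k * n := by
  induction k with
  | zero => simp
  | succ k ih =>
    rw [Function.iterate_succ_apply']
    linear_combination d ^ k * h k k.lt_succ_self + a * ih fun i hi => h i (hi.trans k.lt_succ_self)

/-- suppose `b_0 = 0` and `a_0 ≠ d_0`. If `n ∈ ℤ`, `m ≥ 1`,
`H^[m] n = n`, and `ϱ ∣ H^[k] n` for every `0 ≤ k ≤ m−1`, then `n = 0`. -/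
theorem stmt12 (ϱ : ℕ) (hϱ : 2 ≤ ϱ) (a d b : ℕ → ℤ)
    (ha : ∀ j < ϱ, 0 < a j) (hd : ∀ j < ϱ, 0 < d j) (hb0 : b 0 = 0)
    (had : a 0 ≠ d 0)
    (H : ℤ → ℤ)
    (hH : ∀ n : ℤ, d (n % (ϱ : ℤ)).toNat * H n
        = a (n % (ϱ : ℤ)).toNat * n + b (n % (ϱ : ℤ)).toNat)
    (n : ℤ) (m : ℕ) (hm : 1 ≤ m) (hper : H^[m] n = n)
    (hdiv : ∀ k < m, (ϱ : ℤ) ∣ H^[k] n) :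
    n = 0 := by
  have hϱ0 : 0 < ϱ := by omega
  have hstep : ∀ k < m, d 0 * H (H^[k] n) = a 0 * H^[k] n := fun k hk => by
    simpa [Int.emod_eq_zero_of_dvd (hdiv k hk), hb0] using hH (H^[k] n)
  have hpow := pow_mul_iterate_eq hstep
  rw [hper] at hpow
  by_contra hn
  exact had ((pow_left_inj₀ (ha 0 hϱ0).le (hd 0 hϱ0).le (by omega)).mp
    (mul_right_cancel₀ hn hpow).symm)
end

section
/- Suppose H is basic. Let x ∈ ℤ be a periodic point of H whose cycle contains at least two elements, i.e., H^{∘L}(x) = x for some L ≥ 2 and H(x) ≠ x. Then there exist an element y of the cycle {x, H(x), …, H^{∘(L−1)}(x)} and a finite string j = (j_1,…,j_{L'}) of elements of {0,…,ϱ−1} with L' ≥ 2 such that ϱ^{L'} ≠ ∏_{k=1}^{L'} a_{j_k} and y·(ϱ^{L'} − ∏_{k=1}^{L'} a_{j_k}) = Σ_{n=1}^{L'} b_{j_n}·(∏_{k=1}^{n−1} a_{j_k})·ϱ^{L'−n}. -/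
/-- The residues modulo `ϱ` of the first `n` iterates of `x` under `H`, latest iterate first. -/
def orbitDigits (ϱ : ℕ) (H : ℤ → ℤ) (x : ℤ) : ℕ → List ℕ
  | 0 => []
  | n + 1 => (H^[n] x % (ϱ : ℤ)).toNat :: orbitDigits ϱ H x n

theorem length_orbitDigits (ϱ : ℕ) (H : ℤ → ℤ) (x : ℤ) (n : ℕ) :
    (orbitDigits ϱ H x n).length = n := by
  induction n with
  | zero => rfl
  | succ n ih => simp [orbitDigits, ih]

theorem lt_of_mem_orbitDigits {ϱ : ℕ} (hϱ : 0 < ϱ) (H : ℤ → ℤ) (x : ℤ) (n : ℕ) :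
    ∀ e ∈ orbitDigits ϱ H x n, e < ϱ := by
  induction n with
  | zero => simp [orbitDigits]
  | succ n ih =>
    intro e he
    rcases List.mem_cons.1 he with rfl | he
    · have := Int.emod_lt_of_pos (H^[n] x) (b := (ϱ : ℤ)) (by omega)
      omega
    · exact ih e he

/-- The translation part of the composite of the affine maps indexed by `d :: l`. -/
theorem sum_getD_cons (a b : ℕ → ℤ) (r : ℤ) (d : ℕ) (l : List ℕ) :
    ∑ m ∈ Finset.range (d :: l).length,
        b ((d :: l).getD m 0) * (((d :: l).take m).map a).prod * r ^ ((d :: l).length - 1 - m)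
      = a d * ∑ m ∈ Finset.range l.length,
          b (l.getD m 0) * ((l.take m).map a).prod * r ^ (l.length - 1 - m)
        + b d * r ^ l.length := by
  rw [List.length_cons, Finset.sum_range_succ', Finset.mul_sum]
  congr 1
  · refine Finset.sum_congr rfl fun m _ => ?_
    have h : l.length + 1 - 1 - (m + 1) = l.length - 1 - m := by omega
    rw [h, List.getD_cons_succ, List.take_succ_cons, List.map_cons, List.prod_cons]
    ring
  · simp

theorem pow_mul_iterate_eq_s15 (ϱ : ℕ) (a b : ℕ → ℤ) (H : ℤ → ℤ)
    (hH : ∀ n : ℤ, (ϱ : ℤ) * H n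
        = a (n % (ϱ : ℤ)).toNat * n + b (n % (ϱ : ℤ)).toNat) (x : ℤ) (n : ℕ) :
    (ϱ : ℤ) ^ n * H^[n] x = ((orbitDigits ϱ H x n).map a).prod * x
      + ∑ m ∈ Finset.range (orbitDigits ϱ H x n).length,
          b ((orbitDigits ϱ H x n).getD m 0) * (((orbitDigits ϱ H x n).take m).map a).prod
            * (ϱ : ℤ) ^ ((orbitDigits ϱ H x n).length - 1 - m) := by
  induction n with
  | zero => simp [orbitDigits]
  | succ n ih =>
    rw [orbitDigits, sum_getD_cons, length_orbitDigits, Function.iterate_succ_apply',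
      pow_succ, mul_assoc, hH, List.map_cons, List.prod_cons]
    rw [length_orbitDigits] at ih
    linear_combination a (H^[n] x % (ϱ : ℤ)).toNat * ih

theorem isCoprime_prod_map {a : ℕ → ℤ} {r : ℤ} {l : List ℕ}
    (h : ∀ e ∈ l, IsCoprime (a e) r) : IsCoprime (l.map a).prod r := by
  induction l with
  | nil => simpa using isCoprime_one_left
  | cons d l ih =>
    rw [List.map_cons, List.prod_cons]
    exact (h d (by simp)).mul_left (ih fun e he => h e (by simp [he]))

/-- suppose `H` is basic. If `x ∈ ℤ` is a periodic point of `H`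
whose cycle has at least two elements (`H^[L] x = x`, `L ≥ 2`, `H x ≠ x`), then
there exist an element `y = H^[k] x` (`k < L`) of the cycle and a finite string
`j = (j_1,…,j_{L'})` of elements of `{0,…,ϱ−1}` with `L' ≥ 2` such that
`ϱ^{L'} ≠ ∏_{k=1}^{L'} a_{j_k}` and
`y·(ϱ^{L'} − ∏_{k=1}^{L'} a_{j_k}) = Σ_{n=1}^{L'} b_{j_n}·(∏_{k=1}^{n−1} a_{j_k})·ϱ^{L'−n}`. -/
theorem stmt15 (ϱ : ℕ) (hϱ : 2 ≤ ϱ) (a b : ℕ → ℤ)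
    (ha : ∀ j < ϱ, 0 < a j) (hb0 : b 0 = 0)
    (hcop : ∀ j < ϱ, Int.gcd (a j) (ϱ : ℤ) = 1)
    (hnd : ∀ j, 0 < j → j < ϱ → a j ≠ 1)
    (hq : (2 : ℤ) ≤ qH ϱ a)
    (hint : ∀ j < ϱ, ∀ ℓ : ℤ, (ϱ : ℤ) ∣ (a j * ℓ + b j) ↔ ℓ % (ϱ : ℤ) = (j : ℤ))
    (H : ℤ → ℤ)
    (hH : ∀ n : ℤ, (ϱ : ℤ) * H n
        = a (n % (ϱ : ℤ)).toNat * n + b (n % (ϱ : ℤ)).toNat)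
    (x : ℤ) (L : ℕ) (hL : 2 ≤ L) (hper : H^[L] x = x) (hfix : H x ≠ x) :
    ∃ k < L, ∃ l : List ℕ, (∀ e ∈ l, e < ϱ) ∧ 2 ≤ l.length ∧
      (ϱ : ℤ) ^ l.length ≠ (l.map a).prod ∧
      (H^[k] x) * ((ϱ : ℤ) ^ l.length - (l.map a).prod)
        = ∑ m ∈ Finset.range l.length,
            b (l.getD m 0) * ((l.take m).map a).prod * (ϱ : ℤ) ^ (l.length - 1 - m) := by
  have hmem := lt_of_mem_orbitDigits (by omega : 0 < ϱ) H x L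
  have hlen := length_orbitDigits ϱ H x L
  refine ⟨0, by omega, orbitDigits ϱ H x L, hmem, by omega, fun heq => ?_, ?_⟩
  · have hc : IsCoprime ((orbitDigits ϱ H x L).map a).prod (ϱ : ℤ) :=
      isCoprime_prod_map fun e he => Int.isCoprime_iff_gcd_eq_one.2 (hcop e (hmem e he))
    rw [← heq, IsCoprime.pow_left_iff (by omega), isCoprime_self, Int.isUnit_iff] at hc
    omega
  · have key := pow_mul_iterate_eq_s15 ϱ a b H hH x L
    rw [hper] at key
    rw [Function.iterate_zero_apply, mul_sub, hlen]
    rw [hlen] at key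
    linear_combination key
end

section
/- Suppose H is basic. Let j = (j_1,…,j_L) be a finite string of elements of {0,…,ϱ−1} with L ≥ 2, and suppose x ∈ ℤ satisfies x·(ϱ^{L} − ∏_{k=1}^{L} a_{j_k}) = Σ_{n=1}^{L} b_{j_n}·(∏_{k=1}^{n−1} a_{j_k})·ϱ^{L−n}. Then x is a periodic point of H: there exists m ≥ 1 with H^{∘m}(x) = x. -/
/-- If `x` is the image of `z` under the composition of the affine branches
`t ↦ (a j * t + b j) / ϱ` indexed by `l`, then `H` iterated `l.length` times sends `z` to `x`. -/
theorem iterate_eq_of_affine_composition (ϱ : ℕ) (hϱ : 0 < ϱ) (a b : ℕ → ℤ)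
    (hcop : ∀ j < ϱ, Int.gcd (a j) (ϱ : ℤ) = 1)
    (hint : ∀ j < ϱ, ∀ ℓ : ℤ, (ϱ : ℤ) ∣ (a j * ℓ + b j) → ℓ % (ϱ : ℤ) = (j : ℤ))
    (H : ℤ → ℤ)
    (hH : ∀ n : ℤ, (ϱ : ℤ) * H n
        = a (n % (ϱ : ℤ)).toNat * n + b (n % (ϱ : ℤ)).toNat)
    (l : List ℕ) (hl : ∀ e ∈ l, e < ϱ) (x z : ℤ)
    (hx : x * (ϱ : ℤ) ^ l.length = (l.map a).prod * z
        + ∑ m ∈ Finset.range l.length,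
            b (l.getD m 0) * ((l.take m).map a).prod * (ϱ : ℤ) ^ (l.length - 1 - m)) :
    H^[l.length] z = x := by
  have hϱ' : (ϱ : ℤ) ≠ 0 := by exact_mod_cast hϱ.ne'
  induction l generalizing x with
  | nil => simpa using hx.symm
  | cons j t ih =>
    have hj : j < ϱ := hl j (by simp)
    have key : x * (ϱ : ℤ) * (ϱ : ℤ) ^ t.length = a j * ((t.map a).prod * z
        + ∑ m ∈ Finset.range t.length,
            b (t.getD m 0) * ((t.take m).map a).prod * (ϱ : ℤ) ^ (t.length - 1 - m))
        + b j * (ϱ : ℤ) ^ t.length := by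
      rw [List.length_cons, Finset.sum_range_succ'] at hx
      simp only [List.getD_cons_succ, List.getD_cons_zero, List.take_succ_cons, List.map_cons,
        List.prod_cons, List.take_zero, List.map_nil, List.prod_nil, Nat.add_sub_cancel,
        Nat.sub_zero] at hx
      rw [mul_add, Finset.mul_sum, mul_assoc, ← pow_succ', hx, add_assoc, mul_assoc, mul_one]
      congr 2
      refine Finset.sum_congr rfl fun m _ => ?_
      rw [show t.length - (m + 1) = t.length - 1 - m by omega]
      ring
    set N := (t.map a).prod * z + ∑ m ∈ Finset.range t.length,
      b (t.getD m 0) * ((t.take m).map a).prod * (ϱ : ℤ) ^ (t.length - 1 - m) with hN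
    have hdvd : (ϱ : ℤ) ^ t.length ∣ a j * N := ⟨x * ϱ - b j, by linear_combination -key⟩
    have hco : IsCoprime ((ϱ : ℤ) ^ t.length) (a j) :=
      (Int.isCoprime_iff_gcd_eq_one.mpr (hcop j hj)).symm.pow_left
    obtain ⟨y, hy⟩ := hco.dvd_of_dvd_mul_left hdvd
    have hstep : (ϱ : ℤ) * x = a j * y + b j := by
      apply mul_right_cancel₀ (pow_ne_zero t.length hϱ')
      linear_combination key + a j * hy
    have hmod := hint j hj y ⟨x, hstep.symm⟩
    have hHy : H y = x := by
      have h := hH y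
      rw [hmod, Int.toNat_natCast, ← hstep] at h
      exact mul_left_cancel₀ hϱ' h
    rw [List.length_cons, Function.iterate_succ_apply',
      ih (fun e he => hl e (by simp [he])) y (by rw [mul_comm, ← hy]), hHy]

/-- suppose `H` is basic. Let `j = (j_1,…,j_L)` be a finite string
of elements of `{0,…,ϱ−1}` with `L ≥ 2`, and suppose `x ∈ ℤ` satisfies
`x·(ϱ^{L} − ∏_{k=1}^{L} a_{j_k}) = Σ_{n=1}^{L} b_{j_n}·(∏_{k=1}^{n−1} a_{j_k})·ϱ^{L−n}`.
Then `x` is a periodic point of `H`. -/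
theorem stmt16 (ϱ : ℕ) (hϱ : 2 ≤ ϱ) (a b : ℕ → ℤ)
    (ha : ∀ j < ϱ, 0 < a j) (hb0 : b 0 = 0)
    (hcop : ∀ j < ϱ, Int.gcd (a j) (ϱ : ℤ) = 1)
    (hnd : ∀ j, 0 < j → j < ϱ → a j ≠ 1)
    (hq : (2 : ℤ) ≤ qH ϱ a)
    (hint : ∀ j < ϱ, ∀ ℓ : ℤ, (ϱ : ℤ) ∣ (a j * ℓ + b j) ↔ ℓ % (ϱ : ℤ) = (j : ℤ))
    (H : ℤ → ℤ)
    (hH : ∀ n : ℤ, (ϱ : ℤ) * H n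
        = a (n % (ϱ : ℤ)).toNat * n + b (n % (ϱ : ℤ)).toNat)
    (l : List ℕ) (hl : ∀ e ∈ l, e < ϱ) (hlen : 2 ≤ l.length)
    (x : ℤ)
    (hx : x * ((ϱ : ℤ) ^ l.length - (l.map a).prod)
        = ∑ m ∈ Finset.range l.length,
            b (l.getD m 0) * ((l.take m).map a).prod * (ϱ : ℤ) ^ (l.length - 1 - m)) :
    ∃ m : ℕ, 1 ≤ m ∧ H^[m] x = x := by
  exact ⟨l.length, by omega, iterate_eq_of_affine_composition ϱ (by omega) a b hcop
    (fun j hj ℓ => (hint j hj ℓ).mp) H hH l hl x x (by linear_combination hx)⟩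
end
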